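/- arXiv:math/0409322 — 12 statements merged into one kernel-verified Lean document; each statement's English description precedes it below -/
import Mathlib

section
/- Let n, m, a be integers with n, m, a all odd. Then there do not exist vectors x, y in ℤ⁶ such that q(x) = 2n, q(y) = 2m and b(x,y) = a, where q is the quadratic form of the lattice T_gen = U ⊕ U(2) ⊕ A₂(−2). Consequently, an even rank-two lattice with Gram matrix [[2n, a], [a, 2m]] admits no embedding into T_gen when n, m, a are all odd. -/
/-- The symmetric bilinear form of the lattice `T_gen = U ⊕ U(2) ⊕ A₂(-2)` on `ℤ⁶`. -/
def bTgen (x y : Fin 6 → ℤ) : ℤ :=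
  x 0 * y 1 + x 1 * y 0 + 2 * (x 2 * y 3 + x 3 * y 2)
    - 4 * x 4 * y 4 - 4 * x 5 * y 5 + 2 * (x 4 * y 5 + x 5 * y 4)

/-- The associated quadratic form `q(x) = b(x,x)`. -/
def qTgen (x : Fin 6 → ℤ) : ℤ := bTgen x x

/-- If `q(x) / 2` is odd, both coordinates of `x` in the summand `U` are odd. -/
theorem odd_coords_of_qTgen_eq {n : ℤ} (hn : Odd n) {x : Fin 6 → ℤ} (hx : qTgen x = 2 * n) :
    Odd (x 0) ∧ Odd (x 1) := by
  rw [← Int.odd_mul]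
  have h : x 0 * x 1 = n - 2 * (x 2 * x 3 - x 4 * x 4 - x 5 * x 5 + x 4 * x 5) := by
    unfold qTgen bTgen at hx
    linarith
  rw [h]
  exact hn.sub_even (even_two_mul _)

/-- If `n, m, a` are all odd, there are no vectors `x, y ∈ T_gen = U ⊕ U(2) ⊕ A₂(-2)`
with `q(x) = 2n`, `q(y) = 2m` and `b(x,y) = a`; hence the even rank-two lattice with
Gram matrix `[[2n, a], [a, 2m]]` does not embed into `T_gen`. -/
theorem stmt0 (n m a : ℤ) (hn : Odd n) (hm : Odd m) (ha : Odd a) :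
    ¬ ∃ x y : Fin 6 → ℤ, qTgen x = 2 * n ∧ qTgen y = 2 * m ∧ bTgen x y = a := by
  rintro ⟨x, y, hx, hy, hxy⟩
  obtain ⟨hx₀, hx₁⟩ := odd_coords_of_qTgen_eq hn hx
  obtain ⟨hy₀, hy₁⟩ := odd_coords_of_qTgen_eq hm hy
  have h : a = (x 0 * y 1 + x 1 * y 0) + 2 * (x 2 * y 3 + x 3 * y 2
      - 2 * x 4 * y 4 - 2 * x 5 * y 5 + (x 4 * y 5 + x 5 * y 4)) := by
    rw [← hxy, bTgen]
    ring
  rw [← Int.not_even_iff_odd, h] at ha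
  exact ha (((hx₀.mul hy₁).add_odd (hx₁.mul hy₀)).add (even_two_mul _))
end

section
/- Let n, m, a be integers with at least one of n, m, a even. Then there exist ℤ-linearly independent vectors x, y in ℤ⁴ such that q(x) = 2n, q(y) = 2m, b(x,y) = a, and the submodule ℤx + ℤy is primitive (saturated) in ℤ⁴, where b is the bilinear form of the lattice U ⊕ U(2). In particular, every even rank-two lattice with Gram matrix [[2n, a], [a, 2m]] with at least one of n, m, a even embeds primitively into U ⊕ U(2), and hence into T_gen = U ⊕ U(2) ⊕ A₂(−2). -/
/-- The symmetric bilinear form of the lattice `U ⊕ U(2)` on `ℤ⁴`. -/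
def bUU2 (x y : Fin 4 → ℤ) : ℤ :=
  x 0 * y 1 + x 1 * y 0 + 2 * (x 2 * y 3 + x 3 * y 2)

/-- The associated quadratic form `q(x) = 2x₁x₂ + 4x₃x₄`. -/
def qUU2 (x : Fin 4 → ℤ) : ℤ := bUU2 x x

/-- Two integer vectors with a `2 × 2` minor equal to `1` are linearly independent. -/
theorem linearIndependent_pair_of_minor_eq_one {ι : Type*} {x y : ι → ℤ} {i j : ι}
    (h : x i * y j - x j * y i = 1) : LinearIndependent ℤ ![x, y] := by
  rw [LinearIndependent.pair_iff]
  intro s t hst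
  have hi := congrFun hst i
  have hj := congrFun hst j
  simp only [Pi.add_apply, Pi.smul_apply, smul_eq_mul, Pi.zero_apply] at hi hj
  constructor
  · linear_combination y j * hi - y i * hj - s * h
  · linear_combination x i * hj - x j * hi - t * h

/-- Two integer vectors with a `2 × 2` minor equal to `1` span a saturated submodule. -/
theorem mem_span_pair_of_smul_mem_of_minor_eq_one {ι : Type*} {x y : ι → ℤ} {i j : ι}
    (h : x i * y j - x j * y i = 1) {k : ℤ} (hk : k ≠ 0) {v : ι → ℤ}
    (hv : k • v ∈ Submodule.span ℤ {x, y}) : v ∈ Submodule.span ℤ {x, y} := by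
  rw [Submodule.mem_span_pair] at hv ⊢
  obtain ⟨s, t, hst⟩ := hv
  have hcoord (l : ι) : s * x l + t * y l = k * v l := by
    simpa using congrFun hst l
  refine ⟨v i * y j - v j * y i, x i * v j - x j * v i, funext fun l => mul_left_cancel₀ hk ?_⟩
  simp only [Pi.add_apply, Pi.smul_apply, smul_eq_mul]
  linear_combination (x j * y l - x l * y j) * hcoord i + (x l * y i - x i * y l) * hcoord j +
    hcoord l + (s * x l + t * y l) * h

/-- If at least one of `n, m, a` is even, then there exist linearly independent vectors
`x, y ∈ U ⊕ U(2)` with `q(x) = 2n`, `q(y) = 2m`, `b(x,y) = a`, spanning a primitive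
(saturated) submodule of `ℤ⁴`; i.e. the even rank-two lattice with Gram matrix
`[[2n, a], [a, 2m]]` embeds primitively into `U ⊕ U(2)`. -/
theorem stmt1 (n m a : ℤ) (h : Even n ∨ Even m ∨ Even a) :
    ∃ x y : Fin 4 → ℤ,
      LinearIndependent ℤ ![x, y] ∧
      qUU2 x = 2 * n ∧ qUU2 y = 2 * m ∧ bUU2 x y = a ∧
      ∀ k : ℤ, k ≠ 0 → ∀ v : Fin 4 → ℤ,
        k • v ∈ Submodule.span ℤ {x, y} → v ∈ Submodule.span ℤ {x, y} := by
  suffices H : ∃ x y : Fin 4 → ℤ, (∃ i j, x i * y j - x j * y i = 1) ∧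
      qUU2 x = 2 * n ∧ qUU2 y = 2 * m ∧ bUU2 x y = a by
    obtain ⟨x, y, ⟨i, j, hij⟩, hx, hy, hxy⟩ := H
    exact ⟨x, y, linearIndependent_pair_of_minor_eq_one hij, hx, hy, hxy,
      fun _ hk _ => mem_span_pair_of_smul_mem_of_minor_eq_one hij hk⟩
  rcases Int.even_or_odd' m with ⟨c, rfl | rfl⟩
  · refine ⟨![1, n, 0, 0], ![0, a, 1, c], ⟨0, 2, by simp⟩, ?_, ?_, ?_⟩ <;>
      simp [qUU2, bUU2] <;> ring
  rcases Int.even_or_odd' n with ⟨d, rfl | rfl⟩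
  · refine ⟨![0, a, 1, d], ![1, 2 * c + 1, 0, 0], ⟨2, 0, by simp⟩, ?_, ?_, ?_⟩ <;>
      simp [qUU2, bUU2] <;> ring
  obtain ⟨e, rfl⟩ : Even a := by
    rcases h with h | h | h <;> grind
  refine ⟨![1, 2 * d + 1, 0, 0], ![1, e + e - (2 * d + 1), 1, c + d + 1 - e],
    ⟨0, 2, by simp⟩, ?_, ?_, ?_⟩ <;> simp [qUU2, bUU2] <;> ring
end

section
/- Let λ₀, …, λ₄ ∈ ℂ. Consider the cubic polynomial F(x₀,x₁,x₂,x₃) = λ₀x₀³ + λ₁x₁³ + λ₂x₂³ + λ₃x₃³ + λ₄x₄³, where x₄ = −(x₀ + x₁ + x₂ + x₃). Then F has a critical point at some nonzero (x₀,x₁,x₂,x₃) ∈ ℂ⁴ (equivalently, the equations λᵢxᵢ² = λ₄x₄² for i = 0,1,2,3 have a nonzero solution; equivalently, the projective cubic surface F = 0 is singular) if and only if there exist μ₀, …, μ₄ ∈ ℂ with μᵢ² = ∏_{j ≠ i} λⱼ for each i and μ₀ + μ₁ + μ₂ + μ₃ + μ₄ = 0. -/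
/-- A cubic surface in Sylvester form `F = Σ λᵢxᵢ³` (with `x₄ = -(x₀+x₁+x₂+x₃)`) is
singular — i.e. the critical-point equations `λᵢxᵢ² = λ₄x₄²` (for `i = 0,…,3`) have a
nonzero solution — if and only if there are `μ₀,…,μ₄ ∈ ℂ` with `μᵢ² = ∏_{j≠i} λⱼ`
and `μ₀ + μ₁ + μ₂ + μ₃ + μ₄ = 0`. -/
theorem stmt2 (l0 l1 l2 l3 l4 : ℂ) :
    (∃ x0 x1 x2 x3 : ℂ, ¬(x0 = 0 ∧ x1 = 0 ∧ x2 = 0 ∧ x3 = 0) ∧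
      (l0 * x0 ^ 2 = l4 * (-(x0 + x1 + x2 + x3)) ^ 2 ∧
       l1 * x1 ^ 2 = l4 * (-(x0 + x1 + x2 + x3)) ^ 2 ∧
       l2 * x2 ^ 2 = l4 * (-(x0 + x1 + x2 + x3)) ^ 2 ∧
       l3 * x3 ^ 2 = l4 * (-(x0 + x1 + x2 + x3)) ^ 2)) ↔
    (∃ m0 m1 m2 m3 m4 : ℂ,
      m0 ^ 2 = l1 * l2 * l3 * l4 ∧
      m1 ^ 2 = l0 * l2 * l3 * l4 ∧
      m2 ^ 2 = l0 * l1 * l3 * l4 ∧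
      m3 ^ 2 = l0 * l1 * l2 * l4 ∧
      m4 ^ 2 = l0 * l1 * l2 * l3 ∧
      m0 + m1 + m2 + m3 + m4 = 0) := by
  constructor
  · rintro ⟨x0, x1, x2, x3, hx, h0, h1, h2, h3⟩
    obtain ⟨x4, h4⟩ : ∃ x4, x4 = -(x0 + x1 + x2 + x3) := ⟨_, rfl⟩
    rw [← h4] at h0 h1 h2 h3
    by_cases hc : l4 * x4 ^ 2 = 0
    · -- At least two of the `xᵢ` are nonzero, so at least two of the `lᵢ` vanish.
      rw [hc] at h0 h1 h2 h3
      simp only [mul_eq_zero, pow_eq_zero_iff two_ne_zero] at hc h0 h1 h2 h3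
      refine ⟨0, 0, 0, 0, 0, ?_⟩
      rcases h0 with h0 | h0 <;> rcases h1 with h1 | h1 <;> rcases h2 with h2 | h2 <;>
        rcases h3 with h3 | h3 <;> rcases hc with hc | hc <;> grind
    · have hl4 : l4 ≠ 0 := left_ne_zero_of_mul hc
      have hl0 : l0 ≠ 0 := left_ne_zero_of_mul (h0 ▸ hc)
      have hl1 : l1 ≠ 0 := left_ne_zero_of_mul (h1 ▸ hc)
      have hl2 : l2 ≠ 0 := left_ne_zero_of_mul (h2 ▸ hc)
      have hl3 : l3 ≠ 0 := left_ne_zero_of_mul (h3 ▸ hc)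
      obtain ⟨s, hs⟩ := IsAlgClosed.exists_pow_nat_eq
        (l0 * l1 * l2 * l3 * l4 / (l4 * x4 ^ 2)) two_pos
      rw [eq_div_iff hc] at hs
      refine ⟨s * x0, s * x1, s * x2, s * x3, s * x4, mul_left_cancel₀ hl0 ?_,
        mul_left_cancel₀ hl1 ?_, mul_left_cancel₀ hl2 ?_, mul_left_cancel₀ hl3 ?_,
        mul_left_cancel₀ hl4 ?_, ?_⟩
      · linear_combination s ^ 2 * h0 + hs
      · linear_combination s ^ 2 * h1 + hs
      · linear_combination s ^ 2 * h2 + hs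
      · linear_combination s ^ 2 * h3 + hs
      · linear_combination hs
      · linear_combination s * h4
  · rintro ⟨m0, m1, m2, m3, m4, h0, h1, h2, h3, h4, hm⟩
    by_cases hP : l0 * l1 * l2 * l3 * l4 = 0
    · -- One `lᵢ` vanishes, hence all `mⱼ` do, hence a second `lⱼ` vanishes.
      have key : (l0 = 0 ∧ (l1 = 0 ∨ l2 = 0 ∨ l3 = 0 ∨ l4 = 0)) ∨
          (l1 = 0 ∧ (l2 = 0 ∨ l3 = 0 ∨ l4 = 0)) ∨ (l2 = 0 ∧ (l3 = 0 ∨ l4 = 0)) ∨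
          (l3 = 0 ∧ l4 = 0) := by
        simp only [mul_eq_zero] at hP
        rcases hP with (((rfl | rfl) | rfl) | rfl) | rfl <;> simp_all <;> tauto
      rcases key with ⟨rfl, rfl | rfl | rfl | rfl⟩ | ⟨rfl, rfl | rfl | rfl⟩ |
        ⟨rfl, rfl | rfl⟩ | ⟨rfl, rfl⟩
      · exact ⟨1, -1, 0, 0, by simp⟩
      · exact ⟨1, 0, -1, 0, by simp⟩
      · exact ⟨1, 0, 0, -1, by simp⟩
      · exact ⟨1, 0, 0, 0, by simp⟩
      · exact ⟨0, 1, -1, 0, by simp⟩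
      · exact ⟨0, 1, 0, -1, by simp⟩
      · exact ⟨0, 1, 0, 0, by simp⟩
      · exact ⟨0, 0, 1, -1, by simp⟩
      · exact ⟨0, 0, 1, 0, by simp⟩
      · exact ⟨0, 0, 0, 1, by simp⟩
    · have hm4 : -(m0 + m1 + m2 + m3) = m4 := by linear_combination -hm
      refine ⟨m0, m1, m2, m3, ?_, ?_⟩
      · rintro ⟨rfl, -⟩
        exact hP (by linear_combination -l0 * h0)
      · rw [hm4]
        refine ⟨?_, ?_, ?_, ?_⟩
        · linear_combination l0 * h0 - l4 * h4
        · linear_combination l1 * h1 - l4 * h4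
        · linear_combination l2 * h2 - l4 * h4
        · linear_combination l3 * h3 - l4 * h4
end

section
/- Let a₀, a₁, a₂, a₃ ∈ ℂ and let F = x₁³ + x₂³ + x₃³ − x₀²(a₀x₀ + 3a₁x₁ + 3a₂x₂ + 3a₃x₃). Then F has a critical point at some nonzero (x₀,x₁,x₂,x₃) ∈ ℂ⁴ (equivalently, the projective cubic surface F = 0 is singular) if and only if there exist b₁, b₂, b₃ ∈ ℂ with bᵢ² = aᵢ³ for i = 1, 2, 3 and a₀ + 2(b₁ + b₂ + b₃) = 0. -/
open MvPolynomial

theorem sq_eq_cube_iff_exists_sqrt {K : Type*} [Field K] (a b : K) :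
    b ^ 2 = a ^ 3 ↔ ∃ y : K, y ^ 2 = a ∧ a * y = b := by
  constructor
  · intro h
    by_cases ha : a = 0
    · subst ha
      have hb : b = 0 := by simpa using h
      exact ⟨0, by simp, by simp [hb]⟩
    · refine ⟨b / a, ?_, by field_simp⟩
      rw [div_pow, h]
      field_simp
  · rintro ⟨y, rfl, rfl⟩
    ring

/-- A cubic surface of type ns1, defined by
`F = x₁³ + x₂³ + x₃³ - x₀²(a₀x₀ + 3a₁x₁ + 3a₂x₂ + 3a₃x₃)`, is singular — i.e. `F` has a
nonzero critical point in `ℂ⁴` — if and only if there exist `b₁, b₂, b₃ ∈ ℂ` with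
`bᵢ² = aᵢ³` and `a₀ + 2(b₁ + b₂ + b₃) = 0`. -/
theorem stmt6 (a0 a1 a2 a3 : ℂ) :
    let x0 : MvPolynomial (Fin 4) ℂ := X 0
    let x1 : MvPolynomial (Fin 4) ℂ := X 1
    let x2 : MvPolynomial (Fin 4) ℂ := X 2
    let x3 : MvPolynomial (Fin 4) ℂ := X 3
    let F : MvPolynomial (Fin 4) ℂ :=
      x1 ^ 3 + x2 ^ 3 + x3 ^ 3
        - x0 ^ 2 * (C a0 * x0 + C (3 * a1) * x1 + C (3 * a2) * x2 + C (3 * a3) * x3)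
    (∃ v : Fin 4 → ℂ, v ≠ 0 ∧ ∀ k : Fin 4, eval v (pderiv k F) = 0) ↔
      ∃ b1 b2 b3 : ℂ, b1 ^ 2 = a1 ^ 3 ∧ b2 ^ 2 = a2 ^ 3 ∧ b3 ^ 2 = a3 ^ 3 ∧
        a0 + 2 * (b1 + b2 + b3) = 0 := by
  intro x0 x1 x2 x3 F
  have critical_iff (v : Fin 4 → ℂ) : (∀ k : Fin 4, eval v (pderiv k F) = 0) ↔
      v 0 * (a0 * v 0 + 2 * (a1 * v 1 + a2 * v 2 + a3 * v 3)) = 0 ∧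
        v 1 ^ 2 = a1 * v 0 ^ 2 ∧ v 2 ^ 2 = a2 * v 0 ^ 2 ∧ v 3 ^ 2 = a3 * v 0 ^ 2 := by
    simp only [Fin.forall_fin_succ, F, x0, x1, x2, x3]
    simp [pderiv_X, Pi.single_apply, Derivation.leibniz_pow, -mul_eq_zero]
    refine and_congr ?_ (and_congr ?_ (and_congr ?_ ?_)) <;> grind
  simp only [critical_iff, sq_eq_cube_iff_exists_sqrt]
  constructor
  · rintro ⟨v, hv, h, h1, h2, h3⟩
    have hv0 : v 0 ≠ 0 := by
      intro h0
      apply hv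
      funext k
      fin_cases k <;> simp_all
    refine ⟨_, _, _, ⟨v 1 / v 0, ?_, rfl⟩, ⟨v 2 / v 0, ?_, rfl⟩, ⟨v 3 / v 0, ?_, rfl⟩, ?_⟩
    · rw [div_pow, h1]; field_simp
    · rw [div_pow, h2]; field_simp
    · rw [div_pow, h3]; field_simp
    · have := (mul_eq_zero.mp h).resolve_left hv0
      field_simp
      linear_combination this
  · rintro ⟨b1, b2, b3, ⟨y1, h1, rfl⟩, ⟨y2, h2, rfl⟩, ⟨y3, h3, rfl⟩, h⟩
    refine ⟨![1, y1, y2, y3], fun h0 => one_ne_zero (congrFun h0 0), ?_⟩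
    simpa [h1, h2, h3] using h
end

section
/- Let a₀, a₁, a₂, a₃ ∈ ℂ with a₁a₂a₃ ≠ 0, and assume there are no b₁, b₂, b₃ ∈ ℂ with bᵢ² = aᵢ³ and a₀ + 2(b₁ + b₂ + b₃) = 0 (so the cubic surface of type ns1 is smooth). Let H = x₁x₂x₃(a₀x₀ + a₁x₁ + a₂x₂ + a₃x₃) + x₀²(a₁²x₂x₃ + a₂²x₁x₃ + a₃²x₁x₂). Then a nonzero point v ∈ ℂ⁴ is a critical point of H (all four partial derivatives vanish at v) if and only if v is a scalar multiple of one of the seven points p₀ = (1,0,0,0), p₁ = (0,1,0,0), p₂ = (0,0,1,0), p₃ = (0,0,0,1), q₁ = (0,0,a₃,−a₂), q₂ = (0,−a₃,0,a₁), q₃ = (0,a₂,−a₁,0). Hence the Hessian quartic surface H = 0 in ℙ³ has exactly 7 singular points. -/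
open MvPolynomial

/-- The affine critical locus of the Hessian quartic of a cubic surface of type ns1, in coordinates. -/
lemma hessian_critical_cases {a0 a1 a2 a3 x y z w : ℂ} (h1 : a1 ≠ 0) (h2 : a2 ≠ 0) (h3 : a3 ≠ 0)
    (hsmooth : ¬ ∃ b1 b2 b3 : ℂ, b1 ^ 2 = a1 ^ 3 ∧ b2 ^ 2 = a2 ^ 3 ∧ b3 ^ 2 = a3 ^ 3 ∧
      a0 + 2 * (b1 + b2 + b3) = 0)
    (e0 : a0 * (y * z * w) + 2 * x * (a1 ^ 2 * (z * w) + a2 ^ 2 * (y * w) + a3 ^ 2 * (y * z)) = 0)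
    (e1 : z * w * (a0 * x + 2 * a1 * y + a2 * z + a3 * w) + x ^ 2 * (a2 ^ 2 * w + a3 ^ 2 * z) = 0)
    (e2 : y * w * (a0 * x + a1 * y + 2 * a2 * z + a3 * w) + x ^ 2 * (a1 ^ 2 * w + a3 ^ 2 * y) = 0)
    (e3 : y * z * (a0 * x + a1 * y + a2 * z + 2 * a3 * w) + x ^ 2 * (a1 ^ 2 * z + a2 ^ 2 * y) = 0) :
    (y = 0 ∧ z = 0 ∧ w = 0) ∨ (x = 0 ∧ z = 0 ∧ w = 0) ∨ (x = 0 ∧ y = 0 ∧ w = 0) ∨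
      (x = 0 ∧ y = 0 ∧ z = 0) ∨ (x = 0 ∧ y = 0 ∧ a2 * z + a3 * w = 0) ∨
      (x = 0 ∧ z = 0 ∧ a1 * y + a3 * w = 0) ∨ (x = 0 ∧ w = 0 ∧ a1 * y + a2 * z = 0) := by
  by_cases hyzw : y = 0 ∨ z = 0 ∨ w = 0
  · by_cases hx : x = 0
    · subst hx
      rcases hyzw with rfl | rfl | rfl <;> simp_all <;> tauto
    · rcases hyzw with rfl | rfl | rfl <;> simp_all
  push Not at hyzw
  obtain ⟨hy, hz, hw⟩ := hyzw
  exfalso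
  by_cases hx : x = 0
  · subst hx
    have f1 : 2 * a1 * y + a2 * z + a3 * w = 0 := by simpa [hz, hw] using e1
    have f2 : a1 * y + 2 * a2 * z + a3 * w = 0 := by simpa [hy, hw] using e2
    have f3 : a1 * y + a2 * z + 2 * a3 * w = 0 := by simpa [hy, hz] using e3
    exact mul_ne_zero h1 hy (by linear_combination (3 * f1 - f2 - f3) / 4)
  have euler : y * z * w * (a0 * x + a1 * y + a2 * z + a3 * w) +
      x ^ 2 * (a1 ^ 2 * (z * w) + a2 ^ 2 * (y * w) + a3 ^ 2 * (y * z)) = 0 := by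
    linear_combination (x * e0 + y * e1 + z * e2 + w * e3) / 4
  have g1 : y ^ 2 = a1 * x ^ 2 := by
    refine mul_left_cancel₀ (mul_ne_zero (mul_ne_zero h1 hz) hw) ?_
    linear_combination y * e1 - euler
  have g2 : z ^ 2 = a2 * x ^ 2 := by
    refine mul_left_cancel₀ (mul_ne_zero (mul_ne_zero h2 hy) hw) ?_
    linear_combination z * e2 - euler
  have g3 : w ^ 2 = a3 * x ^ 2 := by
    refine mul_left_cancel₀ (mul_ne_zero (mul_ne_zero h3 hy) hz) ?_
    linear_combination w * e3 - euler
  have square_eq_cube {a t : ℂ} (ha : a ≠ 0) (ht : t ^ 2 = a * x ^ 2) :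
      (x * a ^ 2 / t) ^ 2 = a ^ 3 := by
    rw [div_pow, ht]
    field_simp
  refine hsmooth ⟨x * a1 ^ 2 / y, x * a2 ^ 2 / z, x * a3 ^ 2 / w,
    square_eq_cube h1 g1, square_eq_cube h2 g2, square_eq_cube h3 g3, ?_⟩
  field_simp
  linear_combination e0

/-- Let `S_ns1` be a smooth cubic surface of type ns1 with `a₁a₂a₃ ≠ 0`, and let
`H = x₁x₂x₃(a₀x₀+a₁x₁+a₂x₂+a₃x₃) + x₀²(a₁²x₂x₃+a₂²x₁x₃+a₃²x₁x₂)` be (up to scalar) its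
Hessian quartic. A nonzero `v ∈ ℂ⁴` is a critical point of `H` iff `v` is a scalar
multiple of one of `p₀, p₁, p₂, p₃, q₁, q₂, q₃`; hence the Hessian quartic surface has
exactly 7 singular points. -/
theorem stmt7 (a0 a1 a2 a3 : ℂ) (hne : a1 * a2 * a3 ≠ 0)
    (hsmooth : ¬ ∃ b1 b2 b3 : ℂ, b1 ^ 2 = a1 ^ 3 ∧ b2 ^ 2 = a2 ^ 3 ∧ b3 ^ 2 = a3 ^ 3 ∧
      a0 + 2 * (b1 + b2 + b3) = 0) :
    let x0 : MvPolynomial (Fin 4) ℂ := X 0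
    let x1 : MvPolynomial (Fin 4) ℂ := X 1
    let x2 : MvPolynomial (Fin 4) ℂ := X 2
    let x3 : MvPolynomial (Fin 4) ℂ := X 3
    let H : MvPolynomial (Fin 4) ℂ :=
      x1 * x2 * x3 * (C a0 * x0 + C a1 * x1 + C a2 * x2 + C a3 * x3)
        + x0 ^ 2 * (C (a1 ^ 2) * (x2 * x3) + C (a2 ^ 2) * (x1 * x3)
          + C (a3 ^ 2) * (x1 * x2))
    ∀ v : Fin 4 → ℂ, v ≠ 0 →
      ((∀ k : Fin 4, eval v (pderiv k H) = 0) ↔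
        ∃ c : ℂ,
          v = c • ![1, 0, 0, 0] ∨ v = c • ![0, 1, 0, 0] ∨
          v = c • ![0, 0, 1, 0] ∨ v = c • ![0, 0, 0, 1] ∨
          v = c • ![0, 0, a3, -a2] ∨ v = c • ![0, -a3, 0, a1] ∨
          v = c • ![0, a2, -a1, 0]) := by
  intro x0 x1 x2 x3 H v hv
  obtain ⟨⟨h1, h2⟩, h3⟩ : (a1 ≠ 0 ∧ a2 ≠ 0) ∧ a3 ≠ 0 := by simpa [not_or] using hne
  have d0 : eval v (pderiv 0 H) = a0 * (v 1 * v 2 * v 3) +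
      2 * v 0 * (a1 ^ 2 * (v 2 * v 3) + a2 ^ 2 * (v 1 * v 3) + a3 ^ 2 * (v 1 * v 2)) := by
    simp [H, x0, x1, x2, x3, pderiv_X, Derivation.leibniz_pow]
    ring
  have d1 : eval v (pderiv 1 H) = v 2 * v 3 * (a0 * v 0 + 2 * a1 * v 1 + a2 * v 2 + a3 * v 3) +
      v 0 ^ 2 * (a2 ^ 2 * v 3 + a3 ^ 2 * v 2) := by
    simp [H, x0, x1, x2, x3, pderiv_X, Derivation.leibniz_pow]
    ring
  have d2 : eval v (pderiv 2 H) = v 1 * v 3 * (a0 * v 0 + a1 * v 1 + 2 * a2 * v 2 + a3 * v 3) +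
      v 0 ^ 2 * (a1 ^ 2 * v 3 + a3 ^ 2 * v 1) := by
    simp [H, x0, x1, x2, x3, pderiv_X, Derivation.leibniz_pow]
    ring
  have d3 : eval v (pderiv 3 H) = v 1 * v 2 * (a0 * v 0 + a1 * v 1 + a2 * v 2 + 2 * a3 * v 3) +
      v 0 ^ 2 * (a1 ^ 2 * v 2 + a2 ^ 2 * v 1) := by
    simp [H, x0, x1, x2, x3, pderiv_X, Derivation.leibniz_pow]
    ring
  simp only [Fin.forall_fin_succ, IsEmpty.forall_iff, and_true, Fin.succ_zero_eq_one,
    Fin.succ_one_eq_two, show (Fin.succ 2 : Fin 4) = 3 from rfl, d0, d1, d2, d3]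
  have ext4 (p q r s : ℂ) : v = ![p, q, r, s] ↔ v 0 = p ∧ v 1 = q ∧ v 2 = r ∧ v 3 = s := by
    simp [funext_iff, Fin.forall_fin_succ]
  simp only [Matrix.smul_cons, Matrix.smul_empty, smul_eq_mul, mul_zero, mul_one, ext4]
  constructor
  · rintro ⟨e0, e1, e2, e3⟩
    rcases hessian_critical_cases h1 h2 h3 hsmooth e0 e1 e2 e3 with
      ⟨hy, hz, hw⟩ | ⟨hx, hz, hw⟩ | ⟨hx, hy, hw⟩ | ⟨hx, hy, hz⟩ | ⟨hx, hy, h⟩ | ⟨hx, hz, h⟩ |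
        ⟨hx, hw, h⟩
    · exact ⟨v 0, by simp [hy, hz, hw]⟩
    · exact ⟨v 1, by simp [hx, hz, hw]⟩
    · exact ⟨v 2, by simp [hx, hy, hw]⟩
    · exact ⟨v 3, by simp [hx, hy, hz]⟩
    · refine ⟨v 2 / a3, .inr <| .inr <| .inr <| .inr <| .inl ⟨hx, hy, ?_, ?_⟩⟩ <;> field_simp
      linear_combination h
    · refine ⟨v 3 / a1, .inr <| .inr <| .inr <| .inr <| .inr <| .inl ⟨hx, ?_, hz, ?_⟩⟩ <;>
        field_simp
      linear_combination h
    · refine ⟨v 1 / a2, .inr <| .inr <| .inr <| .inr <| .inr <| .inr ⟨hx, ?_, ?_, hw⟩⟩ <;>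
        field_simp
      linear_combination h
  · rintro ⟨c, h | h | h | h | h | h | h⟩ <;> obtain ⟨hx, hy, hz, hw⟩ := h <;>
      refine ⟨?_, ?_, ?_, ?_⟩ <;> rw [hx, hy, hz, hw] <;> ring
end

section
/- Let λ, μ ∈ ℂ and let G = x₁³ + x₂³ + 2λx₃³ − 3x₃(μx₁x₃ + x₂x₃ + x₀²). Then G has a critical point at some nonzero (x₀,x₁,x₂,x₃) ∈ ℂ⁴ (equivalently, the projective cubic surface G = 0 is singular) if and only if there exist c ∈ ℂ and ε ∈ {1, −1} with c² = μ³ and λ = c + ε. -/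
open MvPolynomial

/-- The gradient of the cubic form of type ns2 vanishes at `v` iff these four equations hold. -/
lemma gradient_eq_zero_iff (lam mu : ℂ) (v : Fin 4 → ℂ) :
    (∀ k : Fin 4, eval v (pderiv k (X 1 ^ 3 + X 2 ^ 3 + C (2 * lam) * X 3 ^ 3
        - 3 * X 3 * (C mu * X 1 * X 3 + X 2 * X 3 + X 0 ^ 2) : MvPolynomial (Fin 4) ℂ)) = 0) ↔
      v 3 * v 0 = 0 ∧ v 1 ^ 2 = mu * v 3 ^ 2 ∧ v 2 ^ 2 = v 3 ^ 2 ∧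
        2 * lam * v 3 ^ 2 - 2 * mu * v 1 * v 3 - 2 * v 2 * v 3 - v 0 ^ 2 = 0 := by
  have h3 : (3 : MvPolynomial (Fin 4) ℂ) = C 3 := (map_ofNat C 3).symm
  rw [h3]
  simp only [Fin.forall_fin_succ, IsEmpty.forall_iff, and_true]
  simp [pderiv_X, Derivation.leibniz, Derivation.leibniz_pow, -mul_eq_zero]
  refine and_congr ?_ (and_congr ?_ (and_congr ?_ ?_))
  · constructor <;> intro h
    · linear_combination h / 6
    · linear_combination 6 * h
  · constructor <;> intro h
    · linear_combination (1 / 3) * h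
    · linear_combination 3 * h
  · constructor <;> intro h
    · linear_combination (1 / 3) * h
    · linear_combination 3 * h
  · constructor <;> intro h
    · linear_combination (1 / 3) * h
    · linear_combination 3 * h

/-- A cubic surface of type ns2, defined by
`G = x₁³ + x₂³ + 2λx₃³ - 3x₃(μx₁x₃ + x₂x₃ + x₀²)`, is singular — i.e. `G` has a nonzero
critical point in `ℂ⁴` — if and only if there are `c ∈ ℂ` and `ε ∈ {1, -1}` with
`c² = μ³` and `λ = c + ε`. -/
theorem stmt9 (lam mu : ℂ) :
    let x0 : MvPolynomial (Fin 4) ℂ := X 0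
    let x1 : MvPolynomial (Fin 4) ℂ := X 1
    let x2 : MvPolynomial (Fin 4) ℂ := X 2
    let x3 : MvPolynomial (Fin 4) ℂ := X 3
    let G : MvPolynomial (Fin 4) ℂ :=
      x1 ^ 3 + x2 ^ 3 + C (2 * lam) * x3 ^ 3
        - 3 * x3 * (C mu * x1 * x3 + x2 * x3 + x0 ^ 2)
    (∃ v : Fin 4 → ℂ, v ≠ 0 ∧ ∀ k : Fin 4, eval v (pderiv k G) = 0) ↔
      ∃ c ε : ℂ, (ε = 1 ∨ ε = -1) ∧ c ^ 2 = mu ^ 3 ∧ lam = c + ε := by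
  intro x0 x1 x2 x3 G
  simp only [G, x0, x1, x2, x3, gradient_eq_zero_iff]
  constructor
  · rintro ⟨v, hv, h0, h1, h2, h3⟩
    have hv3 : v 3 ≠ 0 := by
      intro h
      simp only [h, ne_eq, OfNat.ofNat_ne_zero, not_false_eq_true, zero_pow, mul_zero, zero_sub,
        pow_eq_zero_iff, sub_self, neg_eq_zero] at h1 h2 h3
      exact hv (by ext k; fin_cases k <;> simp [h, h1, h2, h3])
    have hv0 : v 0 = 0 := (mul_eq_zero.mp h0).resolve_left hv3
    refine ⟨mu * (v 1 / v 3), v 2 / v 3, ?_, ?_, ?_⟩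
    · rw [← sq_eq_one_iff, div_pow, h2, div_self (pow_ne_zero 2 hv3)]
    · rw [mul_pow, div_pow, h1]
      field_simp
    · rw [hv0] at h3
      field_simp
      apply mul_right_cancel₀ hv3
      linear_combination h3 / 2
  · rintro ⟨c, ε, hε, hc, rfl⟩
    obtain ⟨a, ha, hca⟩ : ∃ a : ℂ, a ^ 2 = mu ∧ mu * a = c := by
      rcases eq_or_ne mu 0 with rfl | hmu
      · have hc0 : c = 0 := by simpa using hc
        exact ⟨0, by simp, by simp [hc0]⟩
      · refine ⟨c / mu, ?_, mul_div_cancel₀ c hmu⟩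
        rw [div_pow, hc]
        field_simp
    refine ⟨![0, a, ε, 1], fun h => one_ne_zero (congrFun h 3), ?_⟩
    have hε2 : ε ^ 2 = 1 := sq_eq_one_iff.mpr hε
    simp [ha, hε2]
    linear_combination (-2) * hca
end

section
/- Let Γ be the graph on 20 vertices consisting of a 16-cycle v₀, v₁, …, v₁₅ (a square with corners v₀, v₄, v₈, v₁₂ and three points on each edge) together with four further vertices w₀, w₁, w₂, w₃, where wⱼ is joined only to the corner v₄ⱼ. Let A be the 20×20 integer matrix with A(u,u) = −2 for every vertex u, A(u,u') = 1 if u and u' are adjacent in Γ, and A(u,u') = 0 otherwise. Let L = ℤ¹⁸ carry the symmetric bilinear form of E₈(−1) ⊕ E₈(−1) ⊕ U(2). Then there exists a map g from the 20 vertices of Γ to L such that ⟨g(u), g(u')⟩ = A(u,u') for all vertices u, u', and the vectors g(u) generate L as an abelian group. (This is the computation showing that the Néron–Severi lattice of the Hessian K3 surface of a general cubic surface of type ns2, which is generated by twenty (−2)-curves with intersection matrix A, is isomorphic to E₈(−1)² ⊕ U(2).) -/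
/-- The E₈ Cartan matrix (as a function of natural-number indices `< 8`): the Dynkin
diagram is the chain `0—1—2—3—4—5—6` with an extra node `7` attached to node `4`. -/
def e8Cartan (i j : ℕ) : ℤ :=
  if i = j then 2
  else if (min i j, max i j) ∈ ([(0, 1), (1, 2), (2, 3), (3, 4), (4, 5), (5, 6), (4, 7)] :
      List (ℕ × ℕ)) then -1
  else 0

/-- The Gram matrix of `E₈(-1) ⊕ E₈(-1) ⊕ U(2)` on `ℤ¹⁸` (entries for indices `< 18`):
two diagonal blocks `-E₈Cartan` followed by the block `[[0,2],[2,0]]`. -/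
def gram18 (i j : ℕ) : ℤ :=
  if i < 8 ∧ j < 8 then -(e8Cartan i j)
  else if 8 ≤ i ∧ i < 16 ∧ 8 ≤ j ∧ j < 16 then -(e8Cartan (i - 8) (j - 8))
  else if (i = 16 ∧ j = 17) ∨ (i = 17 ∧ j = 16) then 2
  else 0

/-- The bilinear form of `E₈(-1) ⊕ E₈(-1) ⊕ U(2)` on `ℤ¹⁸`. -/
def B18 (v w : Fin 18 → ℤ) : ℤ := ∑ i : Fin 18, ∑ j : Fin 18, v i * gram18 i.1 j.1 * w j

/-- The adjacency relation of the graph `Γ` on 20 vertices: a 16-cycle `v₀,…,v₁₅`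
(vertices `0,…,15`) together with four pendant vertices `w₀,…,w₃` (vertices
`16,…,19`), where `wⱼ` is joined only to `v₄ⱼ`. -/
def adj20 (i j : ℕ) : Prop :=
  (i < 16 ∧ j < 16 ∧ (j = (i + 1) % 16 ∨ i = (j + 1) % 16)) ∨
  (16 ≤ i ∧ i < 20 ∧ j = 4 * (i - 16)) ∨ (16 ≤ j ∧ j < 20 ∧ i = 4 * (j - 16))

instance : ∀ i j, Decidable (adj20 i j) := fun i j => by unfold adj20; infer_instance

/-- The intersection matrix of the twenty `(-2)`-curves on the Hessian K3 surface of a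
general cubic surface of type ns2: `-2` on the diagonal, `1` for adjacent vertices of
`Γ`, `0` otherwise. -/
def A20 (i j : ℕ) : ℤ := if i = j then -2 else if adj20 i j then 1 else 0

/-- The rows of an integer matrix with a left inverse generate the ambient lattice. -/
theorem span_range_eq_top_of_mul_eq_one {R m n : Type*} [CommRing R] [Fintype m] [Fintype n]
    [DecidableEq n] (Z : Matrix n m R) (G : Matrix m n R) (h : Z * G = 1) :
    Submodule.span R (Set.range fun u => G u) = ⊤ := by
  rw [eq_top_iff]
  intro x _
  have hx : x = ∑ u, Matrix.vecMul x Z u • G u := by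
    rw [← Matrix.vecMul_eq_sum, Matrix.vecMul_vecMul, h, Matrix.vecMul_one]
  rw [hx]
  exact Submodule.sum_mem _ fun u _ =>
    Submodule.smul_mem _ _ (Submodule.subset_span (Set.mem_range_self u))

/-- The classes of the twenty curves in `E₈(-1) ⊕ E₈(-1) ⊕ U(2)`. The simple roots of the two
copies of `E₈` are the vertices `v₄, v₃, v₂, v₁, v₀, v₁₅, v₁₄, w₀` and
`v₁₂, v₁₁, v₁₀, v₉, v₈, v₇, v₆, w₂`, two orthogonal `E₈` subdiagrams of `Γ`. -/
def curveClass : Fin 20 → Fin 18 → ℤ :=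
  ![![0, 0, 0, 0, 1, 0, 0, 0, 0, 0, 0, 0, 0, 0, 0, 0, 0, 0],
    ![0, 0, 0, 1, 0, 0, 0, 0, 0, 0, 0, 0, 0, 0, 0, 0, 0, 0],
    ![0, 0, 1, 0, 0, 0, 0, 0, 0, 0, 0, 0, 0, 0, 0, 0, 0, 0],
    ![0, 1, 0, 0, 0, 0, 0, 0, 0, 0, 0, 0, 0, 0, 0, 0, 0, 0],
    ![1, 0, 0, 0, 0, 0, 0, 0, 0, 0, 0, 0, 0, 0, 0, 0, 0, 0],
    ![-2, -3, -4, -5, -6, -4, -2, -3, -2, -4, -6, -8, -10, -7, -4, -5, 1, 1],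
    ![0, 0, 0, 0, 0, 0, 0, 0, 0, 0, 0, 0, 0, 0, 1, 0, 0, 0],
    ![0, 0, 0, 0, 0, 0, 0, 0, 0, 0, 0, 0, 0, 1, 0, 0, 0, 0],
    ![0, 0, 0, 0, 0, 0, 0, 0, 0, 0, 0, 0, 1, 0, 0, 0, 0, 0],
    ![0, 0, 0, 0, 0, 0, 0, 0, 0, 0, 0, 1, 0, 0, 0, 0, 0, 0],
    ![0, 0, 0, 0, 0, 0, 0, 0, 0, 0, 1, 0, 0, 0, 0, 0, 0, 0],
    ![0, 0, 0, 0, 0, 0, 0, 0, 0, 1, 0, 0, 0, 0, 0, 0, 0, 0],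
    ![0, 0, 0, 0, 0, 0, 0, 0, 1, 0, 0, 0, 0, 0, 0, 0, 0, 0],
    ![-2, -4, -6, -8, -10, -7, -4, -5, -2, -3, -4, -5, -6, -4, -2, -3, 1, 1],
    ![0, 0, 0, 0, 0, 0, 1, 0, 0, 0, 0, 0, 0, 0, 0, 0, 0, 0],
    ![0, 0, 0, 0, 0, 1, 0, 0, 0, 0, 0, 0, 0, 0, 0, 0, 0, 0],
    ![0, 0, 0, 0, 0, 0, 0, 1, 0, 0, 0, 0, 0, 0, 0, 0, 0, 0],
    ![-2, -3, -4, -5, -6, -4, -2, -3, 0, 0, 0, 0, 0, 0, 0, 0, 1, 0],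
    ![0, 0, 0, 0, 0, 0, 0, 0, 0, 0, 0, 0, 0, 0, 0, 1, 0, 0],
    ![0, 0, 0, 0, 0, 0, 0, 0, -2, -3, -4, -5, -6, -4, -2, -3, 1, 0]]

/-- The pairings of the twenty curve classes with the standard basis of `ℤ¹⁸`. -/
def curvePairing : Fin 20 → Fin 18 → ℤ :=
  ![![0, 0, 0, 1, -2, 1, 0, 1, 0, 0, 0, 0, 0, 0, 0, 0, 0, 0],
    ![0, 0, 1, -2, 1, 0, 0, 0, 0, 0, 0, 0, 0, 0, 0, 0, 0, 0],
    ![0, 1, -2, 1, 0, 0, 0, 0, 0, 0, 0, 0, 0, 0, 0, 0, 0, 0],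
    ![1, -2, 1, 0, 0, 0, 0, 0, 0, 0, 0, 0, 0, 0, 0, 0, 0, 0],
    ![-2, 1, 0, 0, 0, 0, 0, 0, 0, 0, 0, 0, 0, 0, 0, 0, 0, 0],
    ![1, 0, 0, 0, 0, 0, 0, 0, 0, 0, 0, 0, 0, 0, 1, 0, 2, 2],
    ![0, 0, 0, 0, 0, 0, 0, 0, 0, 0, 0, 0, 0, 1, -2, 0, 0, 0],
    ![0, 0, 0, 0, 0, 0, 0, 0, 0, 0, 0, 0, 1, -2, 1, 0, 0, 0],
    ![0, 0, 0, 0, 0, 0, 0, 0, 0, 0, 0, 1, -2, 1, 0, 1, 0, 0],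
    ![0, 0, 0, 0, 0, 0, 0, 0, 0, 0, 1, -2, 1, 0, 0, 0, 0, 0],
    ![0, 0, 0, 0, 0, 0, 0, 0, 0, 1, -2, 1, 0, 0, 0, 0, 0, 0],
    ![0, 0, 0, 0, 0, 0, 0, 0, 1, -2, 1, 0, 0, 0, 0, 0, 0, 0],
    ![0, 0, 0, 0, 0, 0, 0, 0, -2, 1, 0, 0, 0, 0, 0, 0, 0, 0],
    ![0, 0, 0, 0, 0, 0, 1, 0, 1, 0, 0, 0, 0, 0, 0, 0, 2, 2],
    ![0, 0, 0, 0, 0, 1, -2, 0, 0, 0, 0, 0, 0, 0, 0, 0, 0, 0],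
    ![0, 0, 0, 0, 1, -2, 1, 0, 0, 0, 0, 0, 0, 0, 0, 0, 0, 0],
    ![0, 0, 0, 0, 1, 0, 0, -2, 0, 0, 0, 0, 0, 0, 0, 0, 0, 0],
    ![1, 0, 0, 0, 0, 0, 0, 0, 0, 0, 0, 0, 0, 0, 0, 0, 0, 2],
    ![0, 0, 0, 0, 0, 0, 0, 0, 0, 0, 0, 0, 1, 0, 0, -2, 0, 0],
    ![0, 0, 0, 0, 0, 0, 0, 0, 1, 0, 0, 0, 0, 0, 0, 0, 0, 2]]

theorem sum_gram18_mul_curveClass (u : Fin 20) (i : Fin 18) :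
    ∑ j : Fin 18, gram18 i.1 j.1 * curveClass u j = curvePairing u i := by
  decide +kernel +revert

theorem sum_curveClass_mul_curvePairing (u u' : Fin 20) :
    ∑ i : Fin 18, curveClass u i * curvePairing u' i = A20 u.1 u'.1 := by
  decide +kernel +revert

theorem B18_curveClass (u u' : Fin 20) :
    B18 (curveClass u) (curveClass u') = A20 u.1 u'.1 := by
  simp only [B18, mul_assoc, ← Finset.mul_sum, sum_gram18_mul_curveClass,
    sum_curveClass_mul_curvePairing]

/-- The coefficients expressing the standard basis of `ℤ¹⁸` through `curveClass`. -/
def curveClassLeftInverse : Fin 18 → Fin 20 → ℤ :=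
  ![![0, 0, 0, 0, 1, 0, 0, 0, 0, 0, 0, 0, 0, 0, 0, 0, 0, 0, 0, 0],
    ![0, 0, 0, 1, 0, 0, 0, 0, 0, 0, 0, 0, 0, 0, 0, 0, 0, 0, 0, 0],
    ![0, 0, 1, 0, 0, 0, 0, 0, 0, 0, 0, 0, 0, 0, 0, 0, 0, 0, 0, 0],
    ![0, 1, 0, 0, 0, 0, 0, 0, 0, 0, 0, 0, 0, 0, 0, 0, 0, 0, 0, 0],
    ![1, 0, 0, 0, 0, 0, 0, 0, 0, 0, 0, 0, 0, 0, 0, 0, 0, 0, 0, 0],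
    ![0, 0, 0, 0, 0, 0, 0, 0, 0, 0, 0, 0, 0, 0, 0, 1, 0, 0, 0, 0],
    ![0, 0, 0, 0, 0, 0, 0, 0, 0, 0, 0, 0, 0, 0, 1, 0, 0, 0, 0, 0],
    ![0, 0, 0, 0, 0, 0, 0, 0, 0, 0, 0, 0, 0, 0, 0, 0, 1, 0, 0, 0],
    ![0, 0, 0, 0, 0, 0, 0, 0, 0, 0, 0, 0, 1, 0, 0, 0, 0, 0, 0, 0],
    ![0, 0, 0, 0, 0, 0, 0, 0, 0, 0, 0, 1, 0, 0, 0, 0, 0, 0, 0, 0],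
    ![0, 0, 0, 0, 0, 0, 0, 0, 0, 0, 1, 0, 0, 0, 0, 0, 0, 0, 0, 0],
    ![0, 0, 0, 0, 0, 0, 0, 0, 0, 1, 0, 0, 0, 0, 0, 0, 0, 0, 0, 0],
    ![0, 0, 0, 0, 0, 0, 0, 0, 1, 0, 0, 0, 0, 0, 0, 0, 0, 0, 0, 0],
    ![0, 0, 0, 0, 0, 0, 0, 1, 0, 0, 0, 0, 0, 0, 0, 0, 0, 0, 0, 0],
    ![0, 0, 0, 0, 0, 0, 1, 0, 0, 0, 0, 0, 0, 0, 0, 0, 0, 0, 0, 0],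
    ![0, 0, 0, 0, 0, 0, 0, 0, 0, 0, 0, 0, 0, 0, 0, 0, 0, 0, 1, 0],
    ![6, 5, 4, 3, 2, 0, 0, 0, 0, 0, 0, 0, 0, 0, 2, 4, 3, 1, 0, 0],
    ![6, 5, 4, 3, 2, 1, 2, 3, 4, 3, 2, 1, 0, 0, 2, 4, 3, 0, 2, -1]]

/-- There is a Gram-preserving assignment `g` of the twenty vertices of `Γ` to vectors
of `E₈(-1) ⊕ E₈(-1) ⊕ U(2)` which generate the whole lattice; i.e. the Néron–Severi
lattice of the Hessian K3 surface of a general cubic surface of type ns2, generated by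
twenty `(-2)`-curves with intersection matrix `A20`, is isomorphic to
`E₈(-1)² ⊕ U(2)`. -/
theorem stmt11 :
    ∃ g : Fin 20 → (Fin 18 → ℤ),
      (∀ u u' : Fin 20, B18 (g u) (g u') = A20 u.1 u'.1) ∧
      Submodule.span ℤ (Set.range g) = ⊤ := by
  refine ⟨curveClass, B18_curveClass, ?_⟩
  exact span_range_eq_top_of_mul_eq_one curveClassLeftInverse curveClass (by decide +kernel)
end

section
/- In T_gen = ℤ⁶ with bilinear form b(x,y) = x₁y₂ + x₂y₁ + 2(x₃y₄ + x₄y₃) − 4x₅y₅ − 4x₆y₆ + 2(x₅y₆ + x₆y₅), consider the four vectors c₀₁ = (0,0,0,0,0,1), c₁₂ = (0,0,0,−2,1,0), c₂₃ = (0,0,1,2,−2,−1), c₃₄ = (4,−2,−3,−5,4,2). Then b(cᵢ, cᵢ) = −4 for each of the four vectors, b(c₀₁,c₁₂) = b(c₁₂,c₂₃) = b(c₂₃,c₃₄) = 2, and b(c₀₁,c₂₃) = b(c₀₁,c₃₄) = b(c₁₂,c₃₄) = 0 (so their Gram matrix is that of the lattice A₄(−2)); moreover the submodule ℤc₀₁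 + ℤc₁₂ + ℤc₂₃ + ℤc₃₄ is primitive (saturated) in ℤ⁶. Hence A₄(−2) embeds primitively into T_gen = U ⊕ U(2) ⊕ A₂(−2). -/
theorem Submodule.mem_span_quadruple {R M : Type*} [Ring R] [AddCommGroup M] [Module R M]
    {v x y z w : M} :
    v ∈ Submodule.span R {x, y, z, w} ↔
      ∃ a b c d : R, a • x + b • y + c • z + d • w = v := by
  rw [Submodule.mem_span_insert]
  simp_rw [Submodule.mem_span_triple]
  constructor
  · rintro ⟨a, _, ⟨b, c, d, rfl⟩, rfl⟩
    exact ⟨a, b, c, d, by abel⟩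
  · rintro ⟨a, b, c, d, rfl⟩
    exact ⟨a, _, ⟨b, c, d, rfl⟩, by abel⟩

/-- The vectors `c₀₁, c₁₂, c₂₃, c₃₄ ∈ T_gen` have the Gram matrix of `A₄(-2)` and span
a primitive (saturated) submodule of `ℤ⁶`; hence `A₄(-2)` embeds primitively into
`T_gen = U ⊕ U(2) ⊕ A₂(-2)`. -/
theorem stmt12 :
    let c01 : Fin 6 → ℤ := ![0, 0, 0, 0, 0, 1]
    let c12 : Fin 6 → ℤ := ![0, 0, 0, -2, 1, 0]
    let c23 : Fin 6 → ℤ := ![0, 0, 1, 2, -2, -1]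
    let c34 : Fin 6 → ℤ := ![4, -2, -3, -5, 4, 2]
    (bTgen c01 c01 = -4 ∧ bTgen c12 c12 = -4 ∧ bTgen c23 c23 = -4 ∧ bTgen c34 c34 = -4) ∧
    (bTgen c01 c12 = 2 ∧ bTgen c12 c23 = 2 ∧ bTgen c23 c34 = 2) ∧
    (bTgen c01 c23 = 0 ∧ bTgen c01 c34 = 0 ∧ bTgen c12 c34 = 0) ∧
    (∀ k : ℤ, k ≠ 0 → ∀ v : Fin 6 → ℤ,
      k • v ∈ Submodule.span ℤ {c01, c12, c23, c34} →
      v ∈ Submodule.span ℤ {c01, c12, c23, c34}) := by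
  intro c01 c12 c23 c34
  refine ⟨by decide, by decide, by decide, fun k hk v hv => ?_⟩
  rw [Submodule.mem_span_quadruple] at hv ⊢
  obtain ⟨a, b, c, d, h⟩ := hv
  have h0 := congrFun h 0
  have h1 := congrFun h 1
  have h2 := congrFun h 2
  have h3 := congrFun h 3
  have h4 := congrFun h 4
  have h5 := congrFun h 5
  simp [c01, c12, c23, c34] at h0 h1 h2 h3 h4 h5
  -- Solve the system for the coefficients; each one is divisible by `k`.
  obtain ⟨d, rfl⟩ : k ∣ d := ⟨v 1 - v 3 - 2 * v 4 - 2 * v 2, by linarith⟩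
  obtain ⟨c, rfl⟩ : k ∣ c := ⟨v 2 + 3 * d, by linarith⟩
  obtain ⟨b, rfl⟩ : k ∣ b := ⟨v 4 + 2 * c - 4 * d, by linarith⟩
  obtain ⟨a, rfl⟩ : k ∣ a := ⟨v 5 + c - 2 * d, by linarith⟩
  refine ⟨a, b, c, d, smul_right_injective _ hk ?_⟩
  simpa only [smul_add, smul_smul] using h
end

section
/- In T_gen = ℤ⁶ with bilinear form b(x,y) = x₁y₂ + x₂y₁ + 2(x₃y₄ + x₄y₃) − 4x₅y₅ − 4x₆y₆ + 2(x₅y₆ + x₆y₅), let c₀₁ = (0,0,0,0,0,1), c₁₂ = (0,0,0,−2,1,0), c₂₃ = (0,0,1,2,−2,−1), c₃₄ = (4,−2,−3,−5,4,2), and let t₁ = (2,1,0,0,0,0), t₂ = (5,−2,−3,−6,4,2). Then b(t₁,t₁) = 4, b(t₂,t₂) = 4, b(t₁,t₂) = 1, and the set of all v ∈ ℤ⁶ with b(v, c₀₁) = b(v, c₁₂) = b(v, c₂₃) = b(v, c₃₄) = 0 is exactly ℤt₁ + ℤt₂. Hence the orthogonal complement in T_gen of the copy of A₄(−2) spanned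 by the cᵢⱼ is isomorphic to the rank-2 lattice T₁₀ with Gram matrix [[4,1],[1,4]]. -/
/-- The vectors `t₁, t₂` satisfy `b(t₁,t₁) = b(t₂,t₂) = 4`, `b(t₁,t₂) = 1`, and the
orthogonal complement in `T_gen` of the copy of `A₄(-2)` spanned by `c₀₁, c₁₂, c₂₃, c₃₄`
is exactly `ℤt₁ + ℤt₂`; hence this complement is isomorphic to the lattice `T₁₀` with
Gram matrix `[[4,1],[1,4]]`. -/
theorem stmt13 :
    let c01 : Fin 6 → ℤ := ![0, 0, 0, 0, 0, 1]
    let c12 : Fin 6 → ℤ := ![0, 0, 0, -2, 1, 0]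
    let c23 : Fin 6 → ℤ := ![0, 0, 1, 2, -2, -1]
    let c34 : Fin 6 → ℤ := ![4, -2, -3, -5, 4, 2]
    let t1 : Fin 6 → ℤ := ![2, 1, 0, 0, 0, 0]
    let t2 : Fin 6 → ℤ := ![5, -2, -3, -6, 4, 2]
    bTgen t1 t1 = 4 ∧ bTgen t2 t2 = 4 ∧ bTgen t1 t2 = 1 ∧
    ∀ v : Fin 6 → ℤ,
      (bTgen v c01 = 0 ∧ bTgen v c12 = 0 ∧ bTgen v c23 = 0 ∧ bTgen v c34 = 0) ↔
      v ∈ Submodule.span ℤ {t1, t2} := by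
  intro c01 c12 c23 c34 t1 t2
  refine ⟨by decide, by decide, by decide, fun v => ?_⟩
  rw [Submodule.mem_span_pair]
  constructor
  · rintro ⟨h1, h2, h3, h4⟩
    simp [bTgen, c01, c12, c23, c34] at h1 h2 h3 h4
    refine ⟨v 1 - 2 * (v 2 + v 5), -(v 2 + v 5), ?_⟩
    ext i
    fin_cases i <;> simp [t1, t2] <;> omega
  · rintro ⟨a, b, rfl⟩
    refine ⟨?_, ?_, ?_, ?_⟩ <;> simp [bTgen, c01, c12, c23, c34, t1, t2] <;> ring
end

section
/- In ℤ⁶, let c₀₁ = (0,0,0,0,0,1), c₁₂ = (0,0,0,−2,1,0), c₂₃ = (0,0,1,2,−2,−1), c₃₄ = (4,−2,−3,−5,4,2), t₁ = (2,1,0,0,0,0), t₂ = (5,−2,−3,−6,4,2), and u = (6,−2,−3,−6,4,2). Then: (a) the subgroup M of ℤ⁶ generated by t₁, t₂, c₀₁, c₁₂, c₂₃, c₃₄ has index 5 in ℤ⁶; (b) 2(t₁ + t₂) + c₀₁ + 2c₁₂ + 3c₂₃ + 4c₃₄ = 5u; and (c) ℤ⁶ is generated by M together with u. (This is the statement that T₁₀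 ⊕ A₄(−2) embeds into T_gen = U ⊕ U(2) ⊕ A₂(−2) with index 5, and T_gen is generated by T₁₀ ⊕ A₄(−2) and the element (1/5)(2(t₁+t₂) + c₀₁ + 2c₁₂ + 3c₂₃ + 4c₃₄).) -/
/-- The functional `x ↦ x₁ - 2x₂ + 2x₃ + x₄ + 2x₅` on `ℤ⁶`, reduced modulo 5. -/
def glueFunctional : (Fin 6 → ℤ) →+ ZMod 5 :=
  (Int.castAddHom (ZMod 5)).comp
    { toFun := fun x => x 0 - 2 * x 1 + 2 * x 2 + x 3 + 2 * x 4
      map_zero' := by simp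
      map_add' := fun x y => by simp only [Pi.add_apply]; ring }

theorem glueFunctional_apply (x : Fin 6 → ℤ) :
    glueFunctional x = ((x 0 - 2 * x 1 + 2 * x 2 + x 3 + 2 * x 4 : ℤ) : ZMod 5) := rfl

theorem glueFunctional_eq_zero_iff (x : Fin 6 → ℤ) :
    glueFunctional x = 0 ↔ 5 ∣ x 0 - 2 * x 1 + 2 * x 2 + x 3 + 2 * x 4 := by
  rw [glueFunctional_apply]
  exact ZMod.intCast_zmod_eq_zero_iff_dvd _ 5

theorem glueFunctional_surjective : Function.Surjective glueFunctional := by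
  intro z
  obtain ⟨n, rfl⟩ := ZMod.intCast_surjective z
  exact ⟨![n, 0, 0, 0, 0, 0], by simp [glueFunctional_apply]⟩

theorem mem_span_of_dvd {x : Fin 6 → ℤ}
    (hx : 5 ∣ x 0 - 2 * x 1 + 2 * x 2 + x 3 + 2 * x 4) :
    x ∈ Submodule.span ℤ ({![2, 1, 0, 0, 0, 0], ![5, -2, -3, -6, 4, 2], ![0, 0, 0, 0, 0, 1],
      ![0, 0, 0, -2, 1, 0], ![0, 0, 1, 2, -2, -1], ![4, -2, -3, -5, 4, 2]} :
        Set (Fin 6 → ℤ)) := by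
  obtain ⟨k, hk⟩ := hx
  simp only [Submodule.mem_span_insert, Submodule.mem_span_singleton]
  refine ⟨x 1 + 2 * k, _, ⟨x 0 - 2 * x 1 - 8 * k, _, ⟨x 5 + x 2 + k, _,
    ⟨x 4 + 2 * x 2 + 2 * k, _, ⟨x 2 + 3 * k, _, ⟨9 * k - x 0 + 2 * x 1, rfl⟩, rfl⟩, rfl⟩, rfl⟩,
    rfl⟩, ?_⟩
  ext i
  fin_cases i <;> simp <;> linarith

theorem span_toAddSubgroup_eq_ker :
    (Submodule.span ℤ ({![2, 1, 0, 0, 0, 0], ![5, -2, -3, -6, 4, 2], ![0, 0, 0, 0, 0, 1],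
      ![0, 0, 0, -2, 1, 0], ![0, 0, 1, 2, -2, -1], ![4, -2, -3, -5, 4, 2]} :
        Set (Fin 6 → ℤ))).toAddSubgroup = glueFunctional.ker := by
  apply le_antisymm
  · change _ ≤ (AddSubgroup.toIntSubmodule glueFunctional.ker)
    rw [Submodule.span_le]
    rintro x (rfl | rfl | rfl | rfl | rfl | rfl) <;>
      exact (glueFunctional_eq_zero_iff _).2 (by decide)
  · intro x hx
    exact mem_span_of_dvd ((glueFunctional_eq_zero_iff x).1 hx)


/-- The sublattice `T₁₀ ⊕ A₄(-2)` spanned by `t₁, t₂, c₀₁, c₁₂, c₂₃, c₃₄` has index 5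
in `T_gen = ℤ⁶ = U ⊕ U(2) ⊕ A₂(-2)`; moreover
`2(t₁+t₂) + c₀₁ + 2c₁₂ + 3c₂₃ + 4c₃₄ = 5u` with `u = (6,-2,-3,-6,4,2)`, and `T_gen` is
generated by `T₁₀ ⊕ A₄(-2)` together with `u`. -/
theorem stmt14 :
    let c01 : Fin 6 → ℤ := ![0, 0, 0, 0, 0, 1]
    let c12 : Fin 6 → ℤ := ![0, 0, 0, -2, 1, 0]
    let c23 : Fin 6 → ℤ := ![0, 0, 1, 2, -2, -1]
    let c34 : Fin 6 → ℤ := ![4, -2, -3, -5, 4, 2]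
    let t1 : Fin 6 → ℤ := ![2, 1, 0, 0, 0, 0]
    let t2 : Fin 6 → ℤ := ![5, -2, -3, -6, 4, 2]
    let u : Fin 6 → ℤ := ![6, -2, -3, -6, 4, 2]
    (Submodule.span ℤ ({t1, t2, c01, c12, c23, c34} : Set (Fin 6 → ℤ))).toAddSubgroup.index = 5 ∧
    (2 : ℤ) • (t1 + t2) + c01 + (2 : ℤ) • c12 + (3 : ℤ) • c23 + (4 : ℤ) • c34 = (5 : ℤ) • u ∧
    Submodule.span ℤ ({t1, t2, c01, c12, c23, c34, u} : Set (Fin 6 → ℤ)) = ⊤ := by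
  intro c01 c12 c23 c34 t1 t2 u
  refine ⟨?_, by decide, ?_⟩
  · rw [span_toAddSubgroup_eq_ker, AddSubgroup.index_ker,
      AddMonoidHom.range_eq_top.2 glueFunctional_surjective, AddSubgroup.card_top, Nat.card_zmod]
  · rw [eq_top_iff]
    intro x _
    set n : ℤ := x 0 - 2 * x 1 + 2 * x 2 + x 3 + 2 * x 4 with hn
    have hmem : x - n • u ∈ Submodule.span ℤ ({t1, t2, c01, c12, c23, c34} : Set (Fin 6 → ℤ)) :=
      mem_span_of_dvd ⟨-n, by simp [u]; linarith⟩
    rw [← sub_add_cancel x (n • u)]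
    refine add_mem (Submodule.span_mono ?_ hmem)
      (Submodule.smul_mem _ n (Submodule.subset_span (by simp)))
    intro y
    simp only [Set.mem_insert_iff, Set.mem_singleton_iff]
    tauto
end

section
/- Let I be the 20-element index set consisting of the 10 two-element subsets {i,j} and the 10 three-element subsets {i,j,k} of {0,1,2,3,4}, and let M be the 20×20 symmetric integer matrix defined by: M(e,e) = −2 for every e ∈ I; M(p, p') = 0 for distinct two-element subsets p, p'; M(t, t') = 0 for distinct three-element subsets t, t'; and M(p, t) = 1 if the pair p is contained in the triple t, M(p, t) = 0 otherwise. Then: (a) the rank of M (over ℚ) is 16; and (b) the determinant of the 16×16 principal submatrix of M obtained by deleting the rows and columns indexed by {2,3,4}, {1,4}, {2,3} and {2,4} equals −48. (M is the intersection matrix of the twenty (−2)-curves N_{ij}, N_{ijk} on the Hessian K3 surface of a general cubic surface with Sylvester form; thus the lattice NS_gen they generate has rank 16 and discriminant 2⁴·3.) -/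
/-- The index set: the ten two-element and ten three-element subsets of `{0,…,4}`,
indexing the twenty `(-2)`-curves `N_{ij}`, `N_{ijk}` on the Hessian K3 surface of a
general cubic surface with Sylvester form. -/
abbrev NSIdx : Type := {s : Finset (Fin 5) // s.card = 2 ∨ s.card = 3}

/-- The intersection matrix of the twenty `(-2)`-curves: `-2` on the diagonal, `1`
between a pair and a triple containing it, `0` otherwise. -/
def NSMat (e f : NSIdx) : ℤ :=
  if e = f then -2
  else if e.1.card = 2 ∧ f.1.card = 3 ∧ e.1 ⊆ f.1 then 1
  else if e.1.card = 3 ∧ f.1.card = 2 ∧ f.1 ⊆ e.1 then 1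
  else 0

/-- The four index sets deleted to get the 16×16 principal submatrix:
`{2,3,4}, {1,4}, {2,3}, {2,4}`. -/
def NSdeleted : Finset (Finset (Fin 5)) :=
  {({2, 3, 4} : Finset (Fin 5)), {1, 4}, {2, 3}, {2, 4}}

/-- The index set of the 16×16 principal submatrix. -/
abbrev NSIdx16 : Type := {s : Finset (Fin 5) // (s.card = 2 ∨ s.card = 3) ∧ s ∉ NSdeleted}

open Matrix

/-- The triples and pairs that index the 16×16 principal submatrix. The order of the pairs makes
the elimination in `det_pairSchur` integral. -/
def idx16 : Fin 9 ⊕ Fin 7 → NSIdx16 :=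
  Sum.elim
    ![⟨{0, 1, 2}, by decide⟩, ⟨{0, 1, 3}, by decide⟩, ⟨{0, 1, 4}, by decide⟩,
      ⟨{0, 2, 3}, by decide⟩, ⟨{0, 2, 4}, by decide⟩, ⟨{0, 3, 4}, by decide⟩,
      ⟨{1, 2, 3}, by decide⟩, ⟨{1, 2, 4}, by decide⟩, ⟨{1, 3, 4}, by decide⟩]
    ![⟨{0, 2}, by decide⟩, ⟨{1, 3}, by decide⟩, ⟨{0, 3}, by decide⟩, ⟨{1, 2}, by decide⟩,
      ⟨{0, 4}, by decide⟩, ⟨{3, 4}, by decide⟩, ⟨{0, 1}, by decide⟩]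

theorem card_NSIdx16 : Fintype.card NSIdx16 = 16 := by decide +kernel

theorem card_NSIdx : Fintype.card NSIdx = 20 := by decide +kernel

theorem idx16_bijective : Function.Bijective idx16 := by
  rw [Fintype.bijective_iff_injective_and_card, card_NSIdx16]
  exact ⟨by unfold Function.Injective; decide +kernel, by simp⟩

/-- The incidence matrix between the remaining pairs and triples. -/
def pairTriple16 : Matrix (Fin 7) (Fin 9) ℤ :=
  of fun i j => if (idx16 (.inr i)).1 ⊆ (idx16 (.inl j)).1 then 1 else 0

/-- The determinant of a block matrix with diagonal blocks `-2`, in terms of its Schur complement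
and without dividing. -/
theorem det_fromBlocks_neg_two {m n R : Type*} [Fintype m] [Fintype n] [DecidableEq m]
    [DecidableEq n] [CommRing R] (B : Matrix n m R) :
    (fromBlocks (-2) Bᵀ B (-2)).det * 2 ^ Fintype.card n =
      (-2) ^ Fintype.card m * (B * Bᵀ - 4).det := by
  have hmul : fromBlocks (-2) Bᵀ B (-2) * fromBlocks (1 : Matrix m m R) Bᵀ 0 (2 : Matrix n n R) =
      fromBlocks (-2) 0 B (B * Bᵀ - 4) := by
    rw [fromBlocks_multiply]
    congr 1
    · simp
    · rw [← one_add_one_eq_two, ← one_add_one_eq_two]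
      simp [Matrix.add_mul, Matrix.mul_add]
    · simp
    · rw [sub_eq_add_neg]
      norm_num
  have hdet := congrArg det hmul
  rw [det_mul, det_fromBlocks_zero₂₁, det_fromBlocks_zero₁₂, det_one, one_mul] at hdet
  have htwo : (2 : Matrix n n R) = scalar n 2 := (map_ofNat _ 2).symm
  have hneg : (-2 : Matrix m m R) = scalar m (-2) := by
    rw [map_neg, map_ofNat]
  have hn : (2 : Matrix n n R).det = 2 ^ Fintype.card n := by
    rw [htwo, scalar_apply, det_diagonal, Finset.prod_const, Finset.card_univ]
  have hm : (-2 : Matrix m m R).det = (-2) ^ Fintype.card m := by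
    rw [hneg, scalar_apply, det_diagonal, Finset.prod_const, Finset.card_univ]
  rwa [hn, hm] at hdet

/-- The unitriangular matrix of column operations that makes the Schur complement
`B * Bᵀ - 4` lower triangular. -/
def pairElimination : Matrix (Fin 7) (Fin 7) ℤ :=
  !![1, 0, 1, -1,  0, -1,  0;
     0, 1, 1, -1, -1,  0,  0;
     0, 0, 1, -2,  0,  0, -1;
     0, 0, 0,  1, -1, -1,  1;
     0, 0, 0,  0,  1,  0, -1;
     0, 0, 0,  0,  0,  1, -1;
     0, 0, 0,  0,  0,  0,  1]

theorem det_pairSchur : (pairTriple16 * pairTriple16ᵀ - 4).det = 12 := by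
  have hupper : ∀ p : Fin 7 × Fin 7, p.2 < p.1 → pairElimination p.1 p.2 = 0 := by
    decide +kernel
  have hlower : ∀ p : Fin 7 × Fin 7, p.1 < p.2 →
      ((pairTriple16 * pairTriple16ᵀ - 4) * pairElimination : Matrix _ _ ℤ) p.1 p.2 = 0 := by
    decide +kernel
  have hU : pairElimination.det = 1 := by
    rw [det_of_isUpperTriangular fun i j => hupper (i, j)]
    decide +kernel
  rw [← mul_one (det _), ← hU, ← det_mul, det_of_isLowerTriangular _ fun i j => hlower (i, j)]
  decide +kernel

theorem det_NSMat16 :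
    (of fun e f : NSIdx16 => NSMat ⟨e.1, e.2.1⟩ ⟨f.1, f.2.1⟩).det = -48 := by
  have hblocks : (of fun e f : NSIdx16 => NSMat ⟨e.1, e.2.1⟩ ⟨f.1, f.2.1⟩).submatrix
      (Equiv.ofBijective idx16 idx16_bijective) (Equiv.ofBijective idx16 idx16_bijective) =
      fromBlocks (-2) pairTriple16ᵀ pairTriple16 (-2) := by
    decide +kernel
  have h := det_fromBlocks_neg_two pairTriple16
  rw [← hblocks, det_submatrix_equiv_self, det_pairSchur, Fintype.card_fin, Fintype.card_fin] at h
  lia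

/-- Vectors of the form `e ↦ ∑ i ∈ e, c i` with `∑ i, c i = 0` lie in the kernel of `NSMat`; the
columns here come from the `c` that are dual to the four deleted indices. -/
def NSKernel : Matrix NSIdx (Fin 4) ℤ :=
  of fun e k => ∑ i ∈ e.1, (!![ 0, -1, -1,  0;
                               -1,  1,  1,  0;
                               -1,  0,  1,  1;
                                1,  0,  0, -1;
                                1,  0, -1,  0] : Matrix (Fin 5) (Fin 4) ℤ) i k

/-- The four deleted indices, as a family. -/
def deletedIdx : Fin 4 → NSIdx :=
  ![⟨{2, 3, 4}, by decide⟩, ⟨{1, 4}, by decide⟩, ⟨{2, 3}, by decide⟩, ⟨{2, 4}, by decide⟩]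

theorem NSMat_mul_NSKernel : of NSMat * NSKernel = 0 := by
  decide +kernel

theorem NSKernel_submatrix_deletedIdx : NSKernel.submatrix deletedIdx id = 1 := by
  decide +kernel

theorem rank_NSMat : (of fun e f : NSIdx => (NSMat e f : ℚ)).rank = 16 := by
  apply le_antisymm
  · have hmul : (of fun e f : NSIdx => (NSMat e f : ℚ)) *
        NSKernel.map (Int.castRingHom ℚ) = 0 := by
      have h := congrArg (fun A => A.map (Int.castRingHom ℚ)) NSMat_mul_NSKernel
      rwa [Matrix.map_mul, Matrix.map_zero _ (map_zero _)] at h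
    have hrank : 4 ≤ (NSKernel.map (Int.castRingHom ℚ)).rank := by
      have h := rank_submatrix_le (NSKernel.map (Int.castRingHom ℚ)) deletedIdx id
      rwa [submatrix_map, NSKernel_submatrix_deletedIdx,
        Matrix.map_one _ (map_zero _) (map_one _), rank_one, Fintype.card_fin] at h
    have h := rank_add_rank_le_card_of_mul_eq_zero hmul
    rw [card_NSIdx] at h
    lia
  · let A : Matrix NSIdx16 NSIdx16 ℤ := of fun e f => NSMat ⟨e.1, e.2.1⟩ ⟨f.1, f.2.1⟩
    have hdet : (A.map (Int.castRingHom ℚ)).det ≠ 0 := by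
      rw [← RingHom.mapMatrix_apply, ← RingHom.map_det, det_NSMat16]
      norm_num
    rw [← card_NSIdx16, ← rank_of_det_ne_zero hdet]
    exact rank_submatrix_le (of fun e f : NSIdx => (NSMat e f : ℚ))
      (fun e : NSIdx16 => ⟨e.1, e.2.1⟩) (fun f : NSIdx16 => ⟨f.1, f.2.1⟩)

/-- The intersection matrix of the twenty `(-2)`-curves `N_{ij}`, `N_{ijk}` on the
Hessian K3 surface of a general cubic surface with Sylvester form has rank 16 over `ℚ`,
and the 16×16 principal submatrix obtained by deleting the rows and columns indexed by
`{2,3,4}, {1,4}, {2,3}, {2,4}` has determinant `-48`; thus the lattice `NS_gen` they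
generate has rank 16 and discriminant `2⁴·3`. -/
theorem stmt15 :
    (Matrix.of fun e f : NSIdx => ((NSMat e f : ℚ))).rank = 16 ∧
    Fintype.card NSIdx16 = 16 ∧
    (Matrix.of fun e f : NSIdx16 => NSMat ⟨e.1, e.2.1⟩ ⟨f.1, f.2.1⟩).det = -48 :=
  ⟨rank_NSMat, card_NSIdx16, det_NSMat16⟩
end

section
/- Let J be the 40-element index set consisting of the 10 two-element subsets {a,b} of {0,…,4} (indexing curves N_{ab}), the 10 three-element subsets (indexing curves N_{abc}), and the 20 cyclic orderings of three-element subsets of {0,…,4} (indexing curves C_{abc}, where C_{abc} = C_{bca} = C_{cab} and C_{acb} is the other cyclic ordering of the same subset). Let M be the 40×40 symmetric integer matrix with: every diagonal entry −2; M(N_{ab}, N_{cd}) = 0 for distinct pairs; M(N_{abc}, N_{klm}) = 0 for distinct triples; M(N_{ab}, N_{klm}) = 1 iff {a,b} ⊆ {k,l,m}, else 0; M(N_{ab}, C_{klm}) = 1 iff {a,b} ∩ {k,l,m} = ∅, else 0; M(N_{abc}, C_{klm}) = 1 iff {a,b,c} = {k,l,m}, else 0; and for distinct cyclic triples, M(C_{abc},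 C_{klm}) = 1 iff the two cyclic orderings share a common ordered consecutive pair (e.g. C₁₂₄ and C₀₄₁ share the ordered pair (4,1)), else 0. Then: (a) the rank of M over ℚ is 20; and (b) the determinant of the 20×20 principal submatrix of M indexed by all N's except N_{234}, N_{14}, N_{23}, N_{24}, together with C₂₃₄, C₁₃₄, C₁₂₄, C₀₃₂, equals −15. (M is the intersection matrix of the forty (−2)-curves on the Hessian K3 surface X₁₀ of the Clebsch diagonal cubic surface; thus its Néron–Severi lattice has rank 20 and discriminant −15.) -/
/-- Index of the curves `N_{ab}`: two-element subsets of `{0,…,4}`. -/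
abbrev PairIdx : Type := {s : Finset (Fin 5) // s.card = 2}

/-- Index of the curves `N_{abc}`: three-element subsets of `{0,…,4}`. -/
abbrev TripIdx : Type := {s : Finset (Fin 5) // s.card = 3}

/-- Index of the curves `C_{abc}`: cyclic orderings of three-element subsets of
`{0,…,4}`, represented canonically by triples `(a,b,c)` of distinct elements whose
first entry is the smallest. -/
abbrev CycIdx : Type :=
  {t : Fin 5 × Fin 5 × Fin 5 // t.1 < t.2.1 ∧ t.1 < t.2.2 ∧ t.2.1 ≠ t.2.2}

/-- The 40-element index set of the forty `(-2)`-curves on the Hessian K3 surface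
`X₁₀` of the Clebsch diagonal cubic surface. -/
abbrev Idx40 : Type := PairIdx ⊕ TripIdx ⊕ CycIdx

/-- The underlying three-element subset of a cyclic triple. -/
def cycSet (t : Fin 5 × Fin 5 × Fin 5) : Finset (Fin 5) := {t.1, t.2.1, t.2.2}

/-- The ordered consecutive pairs of a cyclic triple `(a,b,c)`:
`(a,b)`, `(b,c)`, `(c,a)` (this set is invariant under cyclic rotation). -/
def cycPairs (t : Fin 5 × Fin 5 × Fin 5) : Finset (Fin 5 × Fin 5) :=
  {(t.1, t.2.1), (t.2.1, t.2.2), (t.2.2, t.1)}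

/-- The intersection matrix of the forty `(-2)`-curves on `X₁₀`. -/
def Mat40 : Idx40 → Idx40 → ℤ
  | .inl p, .inl p' => if p = p' then -2 else 0
  | .inl p, .inr (.inl t) => if p.1 ⊆ t.1 then 1 else 0
  | .inl p, .inr (.inr c) => if Disjoint p.1 (cycSet c.1) then 1 else 0
  | .inr (.inl t), .inl p => if p.1 ⊆ t.1 then 1 else 0
  | .inr (.inl t), .inr (.inl t') => if t = t' then -2 else 0
  | .inr (.inl t), .inr (.inr c) => if t.1 = cycSet c.1 then 1 else 0
  | .inr (.inr c), .inl p => if Disjoint p.1 (cycSet c.1) then 1 else 0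
  | .inr (.inr c), .inr (.inl t) => if t.1 = cycSet c.1 then 1 else 0
  | .inr (.inr c), .inr (.inr c') =>
      if c = c' then -2
      else if (cycPairs c.1 ∩ cycPairs c'.1).Nonempty then 1 else 0

/-- The twenty curves indexing the 20×20 principal submatrix: all `N`'s except
`N₂₃₄`, `N₁₄`, `N₂₃`, `N₂₄`, together with `C₂₃₄`, `C₁₃₄`, `C₁₂₄`, `C₀₃₂`. -/
def basis20 : Fin 20 → Idx40 :=
  ![.inl ⟨{0, 1}, by decide⟩, .inl ⟨{0, 2}, by decide⟩, .inl ⟨{0, 3}, by decide⟩,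
    .inl ⟨{0, 4}, by decide⟩, .inl ⟨{1, 2}, by decide⟩, .inl ⟨{1, 3}, by decide⟩,
    .inl ⟨{3, 4}, by decide⟩,
    .inr (.inl ⟨{0, 1, 2}, by decide⟩), .inr (.inl ⟨{0, 1, 3}, by decide⟩),
    .inr (.inl ⟨{0, 1, 4}, by decide⟩), .inr (.inl ⟨{0, 2, 3}, by decide⟩),
    .inr (.inl ⟨{0, 2, 4}, by decide⟩), .inr (.inl ⟨{0, 3, 4}, by decide⟩),
    .inr (.inl ⟨{1, 2, 3}, by decide⟩), .inr (.inl ⟨{1, 2, 4}, by decide⟩),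
    .inr (.inl ⟨{1, 3, 4}, by decide⟩),
    .inr (.inr ⟨(2, 3, 4), by decide⟩), .inr (.inr ⟨(1, 3, 4), by decide⟩),
    .inr (.inr ⟨(1, 2, 4), by decide⟩), .inr (.inr ⟨(0, 3, 2), by decide⟩)]

/-- The order in which the curves of `basis20` are orthogonalised; in the given order some
leading principal minors vanish. -/
def pivotOrder : Fin 20 → Fin 20 :=
  ![13, 11, 10, 8, 15, 9, 7, 1, 14, 12, 5, 4, 3, 2, 0, 19, 6, 18, 16, 17]

/-- The curves of `basis20`, in pivot order, followed by the twenty remaining curves. -/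
def curve : Fin (20 + 20) → Idx40 :=
  Fin.append (basis20 ∘ pivotOrder) ![
    .inl ⟨{1, 4}, by decide⟩, .inl ⟨{2, 3}, by decide⟩,
    .inl ⟨{2, 4}, by decide⟩, .inr (.inl ⟨{2, 3, 4}, by decide⟩),
    .inr (.inr ⟨(0, 1, 2), by decide⟩), .inr (.inr ⟨(0, 1, 3), by decide⟩),
    .inr (.inr ⟨(0, 1, 4), by decide⟩), .inr (.inr ⟨(0, 2, 1), by decide⟩),
    .inr (.inr ⟨(0, 2, 3), by decide⟩), .inr (.inr ⟨(0, 2, 4), by decide⟩),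
    .inr (.inr ⟨(0, 3, 1), by decide⟩), .inr (.inr ⟨(0, 3, 4), by decide⟩),
    .inr (.inr ⟨(0, 4, 1), by decide⟩), .inr (.inr ⟨(0, 4, 2), by decide⟩),
    .inr (.inr ⟨(0, 4, 3), by decide⟩), .inr (.inr ⟨(1, 2, 3), by decide⟩),
    .inr (.inr ⟨(1, 3, 2), by decide⟩), .inr (.inr ⟨(1, 4, 2), by decide⟩),
    .inr (.inr ⟨(1, 4, 3), by decide⟩), .inr (.inr ⟨(2, 4, 3), by decide⟩)]

/-- The integral lower trapezoidal factor of the decomposition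
`8 M = gramFactor * diagonal gramWeight * gramFactorᵀ`. -/
def gramFactor : Matrix (Fin (20 + 20)) (Fin 20) ℤ :=
  !![2, 0, 0, 0, 0, 0, 0, 0, 0, 0, 0, 0, 0, 0, 0, 0, 0, 0, 0, 0;
    0, 2, 0, 0, 0, 0, 0, 0, 0, 0, 0, 0, 0, 0, 0, 0, 0, 0, 0, 0;
    0, 0, 2, 0, 0, 0, 0, 0, 0, 0, 0, 0, 0, 0, 0, 0, 0, 0, 0, 0;
    0, 0, 0, 2, 0, 0, 0, 0, 0, 0, 0, 0, 0, 0, 0, 0, 0, 0, 0, 0;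
    0, 0, 0, 0, 2, 0, 0, 0, 0, 0, 0, 0, 0, 0, 0, 0, 0, 0, 0, 0;
    0, 0, 0, 0, 0, 2, 0, 0, 0, 0, 0, 0, 0, 0, 0, 0, 0, 0, 0, 0;
    0, 0, 0, 0, 0, 0, 2, 0, 0, 0, 0, 0, 0, 0, 0, 0, 0, 0, 0, 0;
    0, -1, -1, 0, 0, 0, -1, 1, 0, 0, 0, 0, 0, 0, 0, 0, 0, 0, 0, 0;
    0, 0, 0, 0, 0, 0, 0, 0, 2, 0, 0, 0, 0, 0, 0, 0, 0, 0, 0, 0;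
    0, 0, 0, 0, 0, 0, 0, 0, 0, 2, 0, 0, 0, 0, 0, 0, 0, 0, 0, 0;
    -1, 0, 0, -1, -1, 0, 0, 0, 0, 0, 1, 0, 0, 0, 0, 0, 0, 0, 0, 0;
    -1, 0, 0, 0, 0, 0, -1, -1, -1, 0, -1, 1, 0, 0, 0, 0, 0, 0, 0, 0;
    0, -1, 0, 0, 0, -1, 0, -1, 0, -1, 0, 1, 1, 0, 0, 0, 0, 0, 0, 0;
    0, 0, -1, -1, 0, 0, 0, -1, 0, -1, -1, 2, 0, 1, 0, 0, 0, 0, 0, 0;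
    0, 0, 0, -1, 0, -1, -1, -1, 0, 0, -1, 3, 1, 1, 2, 0, 0, 0, 0, 0;
    0, 0, -1, 0, 0, 0, 0, -1, 0, 0, 0, 1, 0, 0, 1, 2, 0, 0, 0, 0;
    0, 0, 0, 0, -1, 0, 0, 0, 0, -1, -1, 1, 0, 0, 1, 0, 1, 0, 0, 0;
    0, 0, 0, 0, 0, 0, 0, 0, -1, 0, 0, 1, 1, 0, 1, 0, 0, 2, 0, 0;
    0, 0, 0, 0, 0, 0, 0, 0, 0, 0, 0, 0, 0, 0, -1, 1, 1, 1, 2, 0;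
    0, 0, 0, 0, -1, 0, 0, -2, 0, 0, -1, 3, 1, 1, 1, 0, 0, -1, -1, 1;
    0, 0, 0, 0, -1, -1, 0, 0, -1, 0, -1, 2, 1, 1, 0, 0, 0, 0, 0, 0;
    -1, 0, -1, 0, 0, 0, 0, -1, 0, 0, -1, 3, 2, 1, 1, 0, 1, 0, 0, 0;
    0, -1, 0, 0, 0, 0, 0, -1, -1, 0, 0, 2, 0, 1, 1, 0, 1, 0, 0, 0;
    0, 0, 0, 0, 0, 0, 0, 0, 0, 0, 0, 0, 0, 0, 0, 0, -2, 0, 0, 0;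
    0, 0, 0, 0, 0, 0, -1, -1, 0, 0, 0, 2, 1, 1, 0, -1, 0, -1, 2, 0;
    0, 0, 0, -1, 0, 0, 0, 0, 0, 0, -1, 1, 1, 0, 0, 1, 0, 0, -1, -1;
    0, 0, 0, 0, 0, -1, 0, 0, 0, 0, 0, 0, -1, 0, 0, 0, 0, 1, -1, 1;
    0, 0, 0, 0, 0, 0, -1, -1, 0, 0, 0, 2, 1, 1, 0, 1, 0, 1, -2, 0;
    0, 0, -1, 0, 0, 0, 0, -1, 0, 0, 0, 1, 0, 0, 1, -2, 0, 0, 0, 0;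
    0, -1, 0, 0, 0, 0, 0, -1, 0, 0, -2, 3, 1, 1, 1, 1, 0, -1, 2, 0;
    0, 0, 0, -1, 0, 0, 0, 0, 0, 0, -1, 1, 1, 0, 0, -1, 0, 0, 1, 1;
    0, 0, 0, 0, 0, 0, 0, 0, 0, -1, 0, 2, 1, 1, 1, -1, 0, 0, -1, -1;
    0, 0, 0, 0, 0, -1, 0, 0, 0, 0, 0, 0, -1, 0, 0, 0, 0, -1, 1, -1;
    0, -1, 0, 0, 0, 0, 0, -1, 0, 0, -2, 3, 1, 1, 1, -1, 0, 1, -2, 0;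
    0, 0, 0, 0, 0, 0, 0, 0, 0, -1, 0, 2, 1, 1, 1, 1, 0, 0, 1, 1;
    -1, 0, 0, 0, 0, 0, 0, 0, 0, 0, -1, 2, 0, 1, 1, 1, 0, -1, -2, 0;
    -1, 0, 0, 0, 0, 0, 0, 0, 0, 0, -1, 2, 0, 1, 1, -1, 0, 1, 2, 0;
    0, 0, 0, 0, 0, 0, 0, 0, -1, 0, 0, 1, 1, 0, 1, 0, 0, -2, 0, 0;
    0, 0, 0, 0, -1, 0, 0, -2, 0, 0, -1, 3, 1, 1, 1, 0, 0, 1, 1, -1;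
    0, 0, 0, 0, 0, 0, 0, 0, 0, 0, 0, 0, 0, 0, -1, -1, 1, -1, -2, 0]

/-- The diagonal factor of the decomposition
`8 M = gramFactor * diagonal gramWeight * gramFactorᵀ`. -/
def gramWeight : Fin 20 → ℤ :=
  ![-4, -4, -4, -4, -4, -4, -4, -4, -4, -4, -4, 4, -4, -12, -4, -2, -4, -2, -1, -5]

theorem pivotOrder_injective : Function.Injective pivotOrder := by decide +kernel

theorem curve_bijective : Function.Bijective curve := by decide +kernel

theorem eight_mul_mat40_curve (i j : Fin (20 + 20)) :
    8 * Mat40 (curve i) (curve j) =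
      ∑ k, gramFactor i k * gramWeight k * gramFactor j k := by
  revert i j
  decide +kernel

/-- The square block of `gramFactor` that belongs to the curves of `basis20`. -/
def gramBlock : Matrix (Fin 20) (Fin 20) ℤ := gramFactor.submatrix (Fin.castAdd 20) id

theorem det_gramBlock_sq_mul_prod_gramWeight :
    gramBlock.det ^ 2 * ∏ k, gramWeight k = 8 ^ 20 * -15 := by
  have h : ∀ i j : Fin 20, i < j → gramFactor (Fin.castAdd 20 i) j = 0 := by
    decide +kernel
  rw [Matrix.det_of_isLowerTriangular gramBlock fun i j hij => h i j hij]
  decide +kernel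

theorem det_basis20 :
    (Matrix.of fun i j : Fin 20 => Mat40 (basis20 i) (basis20 j)).det = -15 := by
  set A := Matrix.of fun i j : Fin 20 => Mat40 (basis20 i) (basis20 j)
  let σ := Equiv.ofBijective pivotOrder
    (Finite.injective_iff_bijective.mp pivotOrder_injective)
  have h : (8 : ℤ) • A.submatrix σ σ =
      gramBlock * Matrix.diagonal gramWeight * gramBlock.transpose := by
    ext i j
    rw [Matrix.mul_apply]
    simpa [A, σ, curve, gramBlock, Matrix.mul_diagonal] using
      eight_mul_mat40_curve (Fin.castAdd 20 i) (Fin.castAdd 20 j)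
  have hdet := congrArg Matrix.det h
  rw [Matrix.det_smul, Matrix.det_submatrix_equiv_self, Matrix.det_mul, Matrix.det_mul,
    Matrix.det_transpose, Matrix.det_diagonal, Fintype.card_fin] at hdet
  linarith [det_gramBlock_sq_mul_prod_gramWeight]

theorem rank_mat40_le :
    (Matrix.of fun e f : Idx40 => ((Mat40 e f : ℚ))).rank ≤ 20 := by
  let e := Equiv.ofBijective curve curve_bijective
  let W : Matrix (Fin (20 + 20)) (Fin 20) ℚ := gramFactor.map (↑)
  have h : (Matrix.of fun e f : Idx40 => ((Mat40 e f : ℚ))).submatrix e e =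
      W * (Matrix.diagonal (fun k => (gramWeight k : ℚ) / 8) * W.transpose) := by
    ext i j
    have hij : (8 : ℚ) * Mat40 (curve i) (curve j) =
        ∑ k, (gramFactor i k : ℚ) * gramWeight k * gramFactor j k :=
      mod_cast eight_mul_mat40_curve i j
    rw [mul_comm, ← eq_div_iff (by norm_num), Finset.sum_div] at hij
    rw [Matrix.mul_apply]
    simp only [Matrix.submatrix_apply, Matrix.of_apply, Matrix.diagonal_mul,
      Matrix.transpose_apply, Matrix.map_apply, e, W,
      Equiv.ofBijective_apply, hij]
    exact Finset.sum_congr rfl fun k _ => by ring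
  rw [← Matrix.rank_submatrix _ e e, h]
  exact (Matrix.rank_mul_le_left _ _).trans (Matrix.rank_le_width _)

theorem le_rank_mat40 :
    20 ≤ (Matrix.of fun e f : Idx40 => ((Mat40 e f : ℚ))).rank := by
  have hdet : ((Matrix.of fun e f : Idx40 => ((Mat40 e f : ℚ))).submatrix
      basis20 basis20).det = -15 := by
    have h := congrArg (Int.cast : ℤ → ℚ) det_basis20
    rw [Int.cast_det] at h
    exact h.trans (by norm_num)
  have hunit := (Matrix.isUnit_iff_isUnit_det _).mpr (hdet ▸ IsUnit.mk0 (-15 : ℚ) (by norm_num))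
  have hrank := Matrix.rank_of_isUnit _ hunit
  rw [Fintype.card_fin] at hrank
  exact hrank ▸ Matrix.rank_submatrix_le _ basis20 basis20

/-- The intersection matrix of the forty `(-2)`-curves `N_{ab}`, `N_{abc}`, `C_{abc}`
on the Hessian K3 surface `X₁₀` of the Clebsch diagonal cubic has rank 20 over `ℚ`,
and the 20×20 principal submatrix indexed by all `N`'s except `N₂₃₄, N₁₄, N₂₃, N₂₄`
together with `C₂₃₄, C₁₃₄, C₁₂₄, C₀₃₂` has determinant `-15`; thus the Néron–Severi
lattice of `X₁₀` has rank 20 and discriminant `-15`. -/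
theorem stmt16 :
    (Matrix.of fun e f : Idx40 => ((Mat40 e f : ℚ))).rank = 20 ∧
    (Matrix.of fun i j : Fin 20 => Mat40 (basis20 i) (basis20 j)).det = -15 := by
  exact ⟨le_antisymm rank_mat40_le le_rank_mat40, det_basis20⟩
end
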